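/- Let A be the Artin group on generators a, b, c with m_{ab} = 3, m_{bc} = 2, m_{ac} ∈ {3,4,5}, with centre Z. Then A_{ab} ∩ Z = {1} and A_{bc} ∩ Z = {1}, where A_{ab} and A_{bc} are the special subgroups generated by {a,b} and {b,c}. -/

import Mathlib

/-- The alternating product `x y x y ⋯` of length `n`. -/
def altG {G : Type*} [Monoid G] : ℕ → G → G → G
  | 0, _, _ => 1
  | n + 1, x, y => x * altG n y x

/-- The Artin relator for generators `i, j` with exponent `m`. -/
def artinRel {α : Type*} (i j : α) (m : ℕ) : FreeGroup α :=
  altG m (FreeGroup.of i) (FreeGroup.of j) * (altG m (FreeGroup.of j) (FreeGroup.of i))⁻¹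

/-- The relators of the three-generator Artin group with
`m_{ab} = 3`, `m_{bc} = 2`, `m_{ac} = m`. -/
def rels3 (m : ℕ) : Set (FreeGroup (Fin 3)) :=
  {artinRel 0 1 3, artinRel 1 2 2, artinRel 0 2 m}

/-- The three-generator Artin group with `m_{ab} = 3`, `m_{bc} = 2`, `m_{ac} = m`. -/
abbrev ArtinThree (m : ℕ) := PresentedGroup (rels3 m)

def genA (m : ℕ) : ArtinThree m := PresentedGroup.of 0
def genB (m : ℕ) : ArtinThree m := PresentedGroup.of 1
def genC (m : ℕ) : ArtinThree m := PresentedGroup.of 2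

theorem map_altG {G H : Type*} [Monoid G] [Monoid H] (φ : G →* H) (n : ℕ) (x y : G) :
    φ (altG n x y) = altG n (φ x) (φ y) := by
  induction n generalizing x y with
  | zero => simp [altG]
  | succ n ih => simp [altG, ih]

/-- A homomorphism `φ` kills the Artin relator iff the images satisfy the Artin relation. -/
theorem map_artinRel_eq_one_iff {α G : Type*} [Group G] (φ : FreeGroup α →* G)
    (i j : α) (m : ℕ) :
    φ (artinRel i j m) = 1 ↔
      altG m (φ (.of i)) (φ (.of j)) = altG m (φ (.of j)) (φ (.of i)) := by
  rw [artinRel, map_mul, map_inv, mul_inv_eq_one, map_altG, map_altG]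

/-- Universal property of the Artin group `ArtinThree m`. -/
theorem ArtinThree.exists_hom {G : Type*} [Group G] {m : ℕ} {x y z : G}
    (hxy : altG 3 x y = altG 3 y x) (hyz : altG 2 y z = altG 2 z y)
    (hxz : altG m x z = altG m z x) :
    ∃ ρ : ArtinThree m →* G, ρ (genA m) = x ∧ ρ (genB m) = y ∧ ρ (genC m) = z := by
  have h : ∀ r ∈ rels3 m, FreeGroup.lift ![x, y, z] r = 1 := by
    rintro r (rfl | rfl | rfl) <;> rw [map_artinRel_eq_one_iff] <;> simpa
  exact ⟨PresentedGroup.toGroup h, by simp [genA], by simp [genB], by simp [genC]⟩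

theorem genA_genB_braid (m : ℕ) :
    genA m * genB m * genA m = genB m * genA m * genB m := by
  have h := (map_artinRel_eq_one_iff (PresentedGroup.mk (rels3 m)) 0 1 3).1
    (PresentedGroup.one_of_mem (by simp [rels3]))
  simpa [altG, mul_assoc, genA, genB, PresentedGroup.of] using h

theorem genB_genC_commute (m : ℕ) : Commute (genB m) (genC m) := by
  have h := (map_artinRel_eq_one_iff (PresentedGroup.mk (rels3 m)) 1 2 2).1
    (PresentedGroup.one_of_mem (by simp [rels3]))
  simpa [altG, Commute, SemiconjBy, genB, genC, PresentedGroup.of] using h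

/-- A normal form in a group generated by `x` and `y` with `x ^ 2 = y ^ 3`. -/
theorem exists_normalForm_of_sq_eq_cube {G : Type*} [Group G] {x y : G} (hxy : x ^ 2 = y ^ 3)
    {g : G} (hg : g ∈ Subgroup.closure {x, y}) :
    ∃ k : ℤ, ∃ i < 3, ∃ w ∈ Submonoid.closure {x * y⁻¹, x⁻¹ * y}, ∃ e < 2,
      g = (x ^ 2) ^ k * (y ^ i * w * x ^ e) := by
  have hx : Commute x (x ^ 2) := (Commute.refl x).pow_right 2
  have hy : Commute y (x ^ 2) := hxy ▸ (Commute.refl y).pow_right 3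
  have key : ∀ g h : G, ∀ k : ℤ, Commute g (x ^ 2) →
      g * ((x ^ 2) ^ k * h) = (x ^ 2) ^ k * (g * h) := fun g h k hc => by
    rw [← mul_assoc, (hc.zpow_right k).eq, mul_assoc]
  let S : G → Prop := fun g => ∃ k : ℤ, ∃ i < 3, ∃ w ∈ Submonoid.closure {x * y⁻¹, x⁻¹ * y},
    ∃ e < 2, g = (x ^ 2) ^ k * (y ^ i * w * x ^ e)
  have hSd : ∀ g, ∀ l : ℤ, S g → S ((x ^ 2) ^ l * g) := by
    rintro _ l ⟨k, i, hi, w, hw, e, he, rfl⟩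
    exact ⟨l + k, i, hi, w, hw, e, he, by rw [zpow_add, mul_assoc ((x ^ 2) ^ l)]⟩
  have hSy : ∀ g, S g → S (y * g) := by
    rintro _ ⟨k, i, hi, w, hw, e, he, rfl⟩
    rw [key _ _ _ hy]
    apply hSd
    obtain hi | rfl : i + 1 < 3 ∨ i = 2 := by omega
    · exact ⟨0, i + 1, hi, w, hw, e, he, by simp [pow_succ', mul_assoc]⟩
    · exact ⟨1, 0, by simp, w, hw, e, he, by rw [hxy]; simp [pow_succ, mul_assoc]⟩
  have hSx : ∀ g, S g → S (x * g) := by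
    rintro _ ⟨k, i, hi, w, hw, e, he, rfl⟩
    rw [key _ _ _ hx]
    apply hSd
    obtain rfl | rfl | rfl : i = 0 ∨ i = 1 ∨ i = 2 := by omega
    · induction hw using Submonoid.closure_induction_left with
      | one =>
        obtain rfl | rfl : e = 0 ∨ e = 1 := by omega
        · exact ⟨0, 0, by simp, 1, one_mem _, 1, by simp, by simp⟩
        · exact ⟨1, 0, by simp, 1, one_mem _, 0, by simp, by simp [pow_two]⟩
      | mul_left u hu w hw _ =>
        rcases hu with rfl | rfl
        · refine ⟨0, 2, by simp, w, hw, e, he, ?_⟩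
          have h : x * (x * y⁻¹) = y ^ 2 := by rw [← mul_assoc, ← pow_two, hxy]; group
          simp only [pow_zero, one_mul, zpow_zero, ← mul_assoc] at h ⊢
          rw [h]
        · exact ⟨0, 1, by simp, w, hw, e, he, by simp [mul_assoc]⟩
    · refine ⟨1, 0, by simp, x⁻¹ * y * w,
        mul_mem (Submonoid.subset_closure (by simp)) hw, e, he, ?_⟩
      simp [pow_two, mul_assoc]
    · refine ⟨1, 0, by simp, x * y⁻¹ * w,
        mul_mem (Submonoid.subset_closure (by simp)) hw, e, he, ?_⟩
      have h : x * y ^ 2 = x ^ 2 * (x * y⁻¹) := by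
        rw [← mul_assoc, ← hx.eq, hxy]; group
      simp only [pow_zero, one_mul, zpow_one, ← mul_assoc] at h ⊢
      rw [h]
  induction hg using Subgroup.closure_induction_left with
  | one => exact ⟨0, 0, by simp, 1, one_mem _, 0, by simp, by simp⟩
  | mul_left u hu g _ ih =>
    rcases hu with rfl | rfl
    · exact hSx _ ih
    · exact hSy _ ih
  | inv_mul_cancel u hu g _ ih =>
    rcases hu with rfl | rfl
    · have h : u⁻¹ * g = (u ^ 2) ^ (-1 : ℤ) * (u * g) := by simp [pow_two, mul_assoc]
      exact h ▸ hSd _ _ (hSx _ ih)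
    · have h : u⁻¹ * g = (x ^ 2) ^ (-1 : ℤ) * (u * (u * g)) := by
        rw [hxy]; simp [pow_succ, mul_assoc]
      exact h ▸ hSd _ _ (hSy _ (hSy _ ih))

/-- A normal form in a quotient of the braid group on three strands. -/
theorem exists_normalForm_of_braid {G : Type*} [Group G] {a b : G} (hab : a * b * a = b * a * b)
    {g : G} (hg : g ∈ Subgroup.closure {a, b}) :
    ∃ k : ℤ, ∃ i < 3, ∃ w ∈ Submonoid.closure {a, b⁻¹}, ∃ e < 2,
      g = ((a * b * a) ^ 2) ^ k * ((b * a) ^ i * w * (a * b * a) ^ e) := by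
  have ha : a * b * a * (b * a)⁻¹ = a := by group
  have hb : (a * b * a)⁻¹ * (b * a) = b⁻¹ := by rw [hab]; group
  have hsq : (a * b * a) ^ 2 = (b * a) ^ 3 := by
    rw [pow_two]
    nth_rewrite 1 [hab]
    simp [pow_succ, mul_assoc]
  have hle : Subgroup.closure {a, b} ≤ Subgroup.closure {a * b * a, b * a} := by
    have hx : a * b * a ∈ Subgroup.closure {a * b * a, b * a} :=
      Subgroup.subset_closure (by simp)
    have hy : b * a ∈ Subgroup.closure {a * b * a, b * a} :=
      Subgroup.subset_closure (by simp)
    have hma := mul_mem hx (inv_mem hy)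
    have hmb := mul_mem (inv_mem hx) hy
    rw [ha] at hma
    rw [hb] at hmb
    rw [Subgroup.closure_le]
    rintro u (rfl | rfl)
    · exact hma
    · exact inv_mem_iff.1 hmb
  simpa only [ha, hb] using exists_normalForm_of_sq_eq_cube hsq (hle hg)

/-- `s` satisfies the equation of `4 cos² (π / m)` over the rationals, for `m = 3, 4, 5`. -/
def IsCosParam (m : ℕ) (s : ℝ) : Prop :=
  m = 3 ∧ s = 1 ∨ m = 4 ∧ s = 2 ∨ m = 5 ∧ s ^ 2 = 3 * s - 1

theorem exists_isCosParam {m : ℕ} (hm : m = 3 ∨ m = 4 ∨ m = 5) : ∃ s, 0 < s ∧ IsCosParam m s := by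
  rcases hm with rfl | rfl | rfl
  · exact ⟨1, by simp, by simp [IsCosParam]⟩
  · exact ⟨2, by simp, by simp [IsCosParam]⟩
  · refine ⟨(3 + √5) / 2, by positivity, .inr (.inr ⟨rfl, ?_⟩)⟩
    have := Real.sq_sqrt (show (0 : ℝ) ≤ 5 by norm_num)
    linarith

theorem exists_zpow_mul_zpow_of_commute {G : Type*} [Group G] {b c : G} (hbc : Commute b c)
    {g : G} (hg : g ∈ Subgroup.closure {b, c}) : ∃ i j : ℤ, g = b ^ i * c ^ j := by
  induction hg using Subgroup.closure_induction with
  | mem u hu =>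
    rcases hu with rfl | rfl
    · exact ⟨1, 0, by simp⟩
    · exact ⟨0, 1, by simp⟩
  | one => exact ⟨0, 0, by simp⟩
  | mul x y _ _ hx hy =>
    obtain ⟨i, j, rfl⟩ := hx
    obtain ⟨k, l, rfl⟩ := hy
    refine ⟨i + k, j + l, ?_⟩
    rw [zpow_add, zpow_add]
    exact (hbc.zpow_zpow k j).symm.mul_mul_mul_comm _ _
  | inv x _ hx =>
    obtain ⟨i, j, rfl⟩ := hx
    exact ⟨-i, -j, by rw [(hbc.zpow_zpow i j).eq, mul_inv_rev, zpow_neg, zpow_neg]⟩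

section Burau

open Matrix

/-- The invertible diagonal matrix with diagonal `v`. -/
def unitsDiagonal (v : Fin 3 → ℝˣ) : (Matrix (Fin 3) (Fin 3) ℝ)ˣ :=
  Units.map (diagonalRingHom (Fin 3) ℝ).toMonoidHom (MulEquiv.piUnits.symm v)

theorem coe_unitsDiagonal_zpow (v : Fin 3 → ℝˣ) (k : ℤ) :
    ((unitsDiagonal v ^ k : (Matrix (Fin 3) (Fin 3) ℝ)ˣ) : Matrix (Fin 3) (Fin 3) ℝ) =
      diagonal fun i => (v i : ℝ) ^ k := by
  have h : unitsDiagonal v ^ k = unitsDiagonal (v ^ k) := by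
    simp [unitsDiagonal, map_zpow]
  rw [h]
  ext i j
  exact congrArg (fun x : Fin 3 → ℝ => diagonal x i j)
    (funext fun i => Units.val_zpow_eq_zpow_val _ _)

theorem coe_unitsDiagonal (x y z : ℝˣ) :
    (unitsDiagonal ![x, y, z] : Matrix (Fin 3) (Fin 3) ℝ) =
      !![↑x, 0, 0; 0, ↑y, 0; 0, 0, ↑z] := by
  ext i j
  fin_cases i <;> fin_cases j <;> simp [unitsDiagonal]

/-- The image of the first generator under a specialised Burau representation, in a basis in
which the first two generators are block diagonal. -/
noncomputable def burauA : (Matrix (Fin 3) (Fin 3) ℝ)ˣ where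
  val := !![2, 1, 0; 0, 1, 0; 0, 0, 1]
  inv := !![1 / 2, -1 / 2, 0; 0, 1, 0; 0, 0, 1]
  val_inv := by rw [one_fin_three, mul_fin_three]; norm_num
  inv_val := by rw [one_fin_three, mul_fin_three]; norm_num

/-- The image of the second generator under the representation of `burauA`. -/
noncomputable def burauB : (Matrix (Fin 3) (Fin 3) ℝ)ˣ where
  val := !![1, 0, 0; -2, 2, 0; 0, 0, 1]
  inv := !![1, 0, 0; 1, 1 / 2, 0; 0, 0, 1]
  val_inv := by rw [one_fin_three, mul_fin_three]; norm_num
  inv_val := by rw [one_fin_three, mul_fin_three]; norm_num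

/-- The image of the third generator under the representation of `burauA`. -/
noncomputable def burauC (s : ℝ) : (Matrix (Fin 3) (Fin 3) ℝ)ˣ where
  val := !![1 - 2 * s / 3, 0, 1 + 2 * s / 3; -4 * s / 3, 1, 2 + 4 * s / 3;
    -2 * s / 3, 0, 2 + 2 * s / 3]
  inv := !![1 + s / 3, 0, -1 / 2 - s / 3; 2 * s / 3, 1, -1 - 2 * s / 3; s / 3, 0, 1 / 2 - s / 3]
  val_inv := by simp [one_fin_three]; refine ⟨?_, ?_, ?_⟩ <;> grind
  inv_val := by simp [one_fin_three]; refine ⟨?_, ?_, ?_⟩ <;> grind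

theorem exists_burau_hom {m : ℕ} {s : ℝ} (hs : IsCosParam m s) :
    ∃ ρ : ArtinThree m →* (Matrix (Fin 3) (Fin 3) ℝ)ˣ,
      ρ (genA m) = burauA ∧ ρ (genB m) = burauB ∧ ρ (genC m) = burauC s := by
  apply ArtinThree.exists_hom
  · refine Units.ext ?_
    norm_num [altG, burauA, burauB, mul_fin_three]
  · refine Units.ext ?_
    simp [altG, burauB, burauC]
    grind
  · rcases hs with ⟨rfl, rfl⟩ | ⟨rfl, rfl⟩ | ⟨rfl, hs⟩ <;> refine Units.ext ?_
    · norm_num [altG, burauA, burauC, mul_fin_three]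
    · norm_num [altG, burauA, burauC, mul_fin_three]
    · norm_num [altG, burauA, burauC, mul_fin_three]
      grind

/-- The image of the first generator under the same representation, in a basis in which
the last two generators are diagonal. -/
noncomputable def burauA' (s : ℝ) : (Matrix (Fin 3) (Fin 3) ℝ)ˣ where
  val := !![-1, -2 * s, 3 + 2 * s; -2, 1 - 2 * s, 3 + 2 * s; -2, -2 * s, 4 + 2 * s]
  inv := !![2, s, -3 / 2 - s; 1, 1 + s, -3 / 2 - s; 1, s, -1 / 2 - s]
  val_inv := by simp [one_fin_three]; grind
  inv_val := by simp [one_fin_three]; grind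

theorem exists_burau_hom' {m : ℕ} {s : ℝ} (hs : IsCosParam m s) :
    ∃ ρ : ArtinThree m →* (Matrix (Fin 3) (Fin 3) ℝ)ˣ,
      ρ (genA m) = burauA' s ∧ ρ (genB m) = unitsDiagonal ![Units.mk0 2 two_ne_zero, 1, 1] ∧
        ρ (genC m) = unitsDiagonal ![1, Units.mk0 2 two_ne_zero, 1] := by
  apply ArtinThree.exists_hom
  · refine Units.ext ?_
    simp [altG, burauA', coe_unitsDiagonal]
    grind
  · refine Units.ext ?_
    simp [altG, coe_unitsDiagonal]
  · rcases hs with ⟨rfl, rfl⟩ | ⟨rfl, rfl⟩ | ⟨rfl, hs⟩ <;> refine Units.ext ?_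
    · norm_num [altG, burauA', coe_unitsDiagonal, mul_fin_three]
    · norm_num [altG, burauA', coe_unitsDiagonal, mul_fin_three]
    · norm_num [altG, burauA', coe_unitsDiagonal, mul_fin_three]
      grind

theorem burauA_mul_burauB_mul_burauA :
    ((burauA * burauB * burauA : (Matrix (Fin 3) (Fin 3) ℝ)ˣ) : Matrix (Fin 3) (Fin 3) ℝ) =
      !![0, 2, 0; -4, 0, 0; 0, 0, 1] := by
  norm_num [burauA, burauB, mul_fin_three]

theorem burauB_mul_burauA :
    ((burauB * burauA : (Matrix (Fin 3) (Fin 3) ℝ)ˣ) : Matrix (Fin 3) (Fin 3) ℝ) =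
      !![2, 1, 0; -4, 0, 0; 0, 0, 1] := by
  norm_num [burauA, burauB, mul_fin_three]

theorem burau_garside_sq :
    (burauA * burauB * burauA) ^ 2 =
      unitsDiagonal ![Units.mk0 (-8) (by norm_num), Units.mk0 (-8) (by norm_num), 1] := by
  refine Units.ext ?_
  rw [pow_two, Units.val_mul, burauA_mul_burauB_mul_burauA, coe_unitsDiagonal]
  norm_num [mul_fin_three]

/-- Words in `a` and `b⁻¹` act by nonnegative matrices on the span of the first two
basis vectors, and nonempty words have a nonzero off-diagonal entry there. -/
theorem burau_positive {G : Type*} [Group G] {a b : G} (ρ : G →* (Matrix (Fin 3) (Fin 3) ℝ)ˣ)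
    (ha : ρ a = burauA) (hb : ρ b = burauB) {w : G} (hw : w ∈ Submonoid.closure {a, b⁻¹}) :
    0 < (ρ w).val 0 0 ∧ 0 ≤ (ρ w).val 0 1 ∧ 0 ≤ (ρ w).val 1 0 ∧ 0 < (ρ w).val 1 1 ∧
      (w = 1 ∨ 0 < (ρ w).val 0 1 + (ρ w).val 1 0) := by
  induction hw using Submonoid.closure_induction_left with
  | one => simp
  | mul_left u hu w _ ih =>
    obtain ⟨h00, h01, h10, h11, -⟩ := ih
    rcases hu with rfl | rfl
    · simp only [map_mul, ha, Units.val_mul, mul_apply, Fin.sum_univ_three]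
      simp only [burauA, of_apply, cons_val]
      refine ⟨?_, ?_, ?_, ?_, .inr ?_⟩ <;> linarith
    · simp only [map_mul, map_inv, hb, Units.val_mul, mul_apply, Fin.sum_univ_three]
      simp only [burauB, Units.inv_mk, of_apply, cons_val]
      refine ⟨?_, ?_, ?_, ?_, .inr ?_⟩ <;> linarith

theorem burau_commute {N : (Matrix (Fin 3) (Fin 3) ℝ)ˣ} (hA : Commute burauA N)
    (hB : Commute burauB N) : N.val 0 1 = 0 ∧ N.val 1 0 = 0 := by
  have h1 := congrArg (fun g : (Matrix (Fin 3) (Fin 3) ℝ)ˣ => g.val 0 0) hA.eq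
  have h2 := congrArg (fun g : (Matrix (Fin 3) (Fin 3) ℝ)ˣ => g.val 0 0) hB.eq
  simp [burauA, mul_apply, Fin.sum_univ_three] at h1
  simp [burauB, mul_apply, Fin.sum_univ_three] at h2
  constructor <;> linarith

theorem closure_genA_genB_inf_center {m : ℕ} (hm : m = 3 ∨ m = 4 ∨ m = 5) :
    (Subgroup.closure {genA m, genB m} : Subgroup (ArtinThree m)) ⊓
      Subgroup.center (ArtinThree m) = ⊥ := by
  obtain ⟨s, hs0, hs⟩ := exists_isCosParam hm
  obtain ⟨ρ, ha, hb, hc⟩ := exists_burau_hom hs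
  rw [eq_bot_iff]
  rintro z ⟨hz, hzc⟩
  have hcomm (g : ArtinThree m) : Commute g z := Subgroup.mem_center_iff.1 hzc g
  obtain ⟨k, i, hi, w, hw, e, he, rfl⟩ := exists_normalForm_of_braid (genA_genB_braid m) hz
  set d := (genA m * genB m * genA m) ^ 2 with hd
  have hρd : ρ d = unitsDiagonal
      ![Units.mk0 (-8) (by norm_num), Units.mk0 (-8) (by norm_num), 1] := by
    rw [hd, map_pow, map_mul, map_mul, ha, hb, burau_garside_sq]
  set g := (genB m * genA m) ^ i * w * (genA m * genB m * genA m) ^ e with hg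
  have hρg : ρ g = ρ d ^ (-k) * ρ (d ^ k * g) := by simp
  obtain ⟨h01, h10⟩ : (ρ g).val 0 1 = 0 ∧ (ρ g).val 1 0 = 0 := by
    obtain ⟨h1, h2⟩ := burau_commute (ha ▸ (hcomm _).map ρ) (hb ▸ (hcomm _).map ρ)
    rw [hρg, hρd, Units.val_mul, coe_unitsDiagonal_zpow]
    simp only [diagonal_mul, h1, h2, mul_zero, and_self]
  obtain ⟨p00, p01, p10, p11, hw1⟩ := burau_positive ρ ha hb hw
  rw [hg] at h01 h10
  simp only [map_mul, map_pow, ha, hb, Units.val_mul, Units.val_pow_eq_pow_val] at h01 h10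
  rw [← Units.val_mul burauB, ← Units.val_mul burauA, ← Units.val_mul (burauA * burauB),
    burauB_mul_burauA, burauA_mul_burauB_mul_burauA] at h01 h10
  obtain ⟨rfl, rfl⟩ : i = 0 ∧ e = 0 := by
    interval_cases i <;> interval_cases e <;>
      simp [pow_two, mul_apply, vecMul, dotProduct, Fin.sum_univ_three] at h01 h10 ⊢ <;> linarith
  obtain rfl : w = 1 := by
    simp only [pow_zero, one_mul, mul_one] at h01 h10
    exact hw1.resolve_right (by linarith)
  have hg1 : g = 1 := by simp [hg]
  rw [hg1, mul_one] at hcomm ⊢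
  have h := congrArg (fun g : (Matrix (Fin 3) (Fin 3) ℝ)ˣ => g.val 0 2) ((hcomm (genC m)).map ρ).eq
  simp only [map_zpow, hρd, hc, Units.val_mul, coe_unitsDiagonal_zpow, diagonal_mul,
    mul_diagonal] at h
  simp [burauC] at h
  have h8 : (-8 : ℝ) ^ k = 1 := by
    have hne : 1 + 2 * s / 3 ≠ 0 := by positivity
    exact mul_right_cancel₀ hne (by linarith)
  have h8' : (8 : ℝ) ^ k = 1 := by simpa [abs_zpow] using congrArg abs h8
  rw [zpow_eq_one_iff_right₀ (by norm_num) (by norm_num)] at h8'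
  simp [h8']

theorem closure_genB_genC_inf_center {m : ℕ} (hm : m = 3 ∨ m = 4 ∨ m = 5) :
    (Subgroup.closure {genB m, genC m} : Subgroup (ArtinThree m)) ⊓
      Subgroup.center (ArtinThree m) = ⊥ := by
  obtain ⟨s, hs0, hs⟩ := exists_isCosParam hm
  obtain ⟨ρ, ha, hb, hc⟩ := exists_burau_hom' hs
  rw [eq_bot_iff]
  rintro z ⟨hz, hzc⟩
  obtain ⟨i, j, rfl⟩ := exists_zpow_mul_zpow_of_commute (genB_genC_commute m) hz
  have h := congrArg (fun g => (ρ g).val) (Subgroup.mem_center_iff.1 hzc (genA m))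
  simp only [map_mul, map_zpow, ha, hb, hc, Units.val_mul, coe_unitsDiagonal_zpow,
    diagonal_mul_diagonal] at h
  have h0 := congrFun₂ h 2 0
  have h1 := congrFun₂ h 2 1
  rw [diagonal_mul, mul_diagonal] at h0 h1
  simp [burauA'] at h0 h1
  have hi : i = 0 := by
    rwa [zpow_eq_one_iff_right₀ (by norm_num) (by norm_num)] at h0
  have hj : j = 0 := by
    rwa [mul_eq_left₀ (by positivity), zpow_eq_one_iff_right₀ (by norm_num) (by norm_num)] at h1
  simp [hi, hj]

end Burau

/-- for the Artin group with `m_{ab}=3`, `m_{bc}=2`, `m_{ac} ∈ {3,4,5}`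
and centre `Z`, the special subgroups `A_{ab}` and `A_{bc}` meet `Z` trivially. -/
theorem artin3_special_subgroups_meet_center_trivially
    (m : ℕ) (hm : m = 3 ∨ m = 4 ∨ m = 5) :
    (Subgroup.closure {genA m, genB m} : Subgroup (ArtinThree m)) ⊓
        Subgroup.center (ArtinThree m) = ⊥ ∧
    (Subgroup.closure {genB m, genC m} : Subgroup (ArtinThree m)) ⊓
        Subgroup.center (ArtinThree m) = ⊥ := by
  exact ⟨closure_genA_genB_inf_center hm, closure_genB_genC_inf_center hm⟩
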